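/- arXiv:1706.05410 — 3 statements merged into one kernel-verified Lean document; each statement's English description precedes it below -/
import Mathlib

section
/- Let K ⊂ ℂ be bounded and convex with diameter s, let n > k be positive integers, and ε > 0 with 16(s+ε)²/ε² < k/(n-k)². Then for every rational function f with at most n zeros and poles combined (counted with multiplicity) and at least k zeros (with multiplicity) lying in K, f has at least k - 1 critical points (with multiplicity) lying in the ε-neighborhood K_ε = { z : dist(z,K) ≤ ε }. -/
open Polynomial Metric Bornology Filter Topology

lemma tendsto_eval_of_tendsto_coeff {ι : Type*} {l : Filter ι} {P : ι → ℂ[X]} {Q : ℂ[X]} {D : ℕ}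
    (hP : ∀ i, (P i).natDegree ≤ D) (hQ : Q.natDegree ≤ D)
    (h : ∀ n, Tendsto (fun i => (P i).coeff n) l (𝓝 (Q.coeff n)))
    {z : ι → ℂ} {z₀ : ℂ} (hz : Tendsto z l (𝓝 z₀)) :
    Tendsto (fun i => (P i).eval (z i)) l (𝓝 (Q.eval z₀)) := by
  have hP' : ∀ i, (P i).eval (z i) = ∑ n ∈ Finset.range (D + 1), (P i).coeff n * z i ^ n :=
    fun i => eval_eq_sum_range' (Nat.lt_succ_of_le (hP i)) _
  simp only [hP', eval_eq_sum_range' (Nat.lt_succ_of_le hQ) z₀]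
  exact tendsto_finsetSum _ fun n _ => (h n).mul (hz.pow n)

lemma coeff_divByMonic_X_sub_C_of_natDegree_le {P : ℂ[X]} {D : ℕ} (hP : P.natDegree ≤ D)
    (a : ℂ) (n : ℕ) :
    (P /ₘ (X - C a)).coeff n = ∑ i ∈ Finset.Icc (n + 1) D, a ^ (i - (n + 1)) * P.coeff i := by
  rw [coeff_divByMonic_X_sub_C]
  refine Finset.sum_subset (Finset.Icc_subset_Icc_right hP) fun i hi hi' => ?_
  rw [coeff_eq_zero_of_natDegree_lt, mul_zero]
  simp only [Finset.mem_Icc] at hi hi'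
  omega

lemma tendsto_coeff_divByMonic_X_sub_C {ι : Type*} {l : Filter ι} {P : ι → ℂ[X]} {Q : ℂ[X]}
    {D : ℕ} (hP : ∀ i, (P i).natDegree ≤ D) (hQ : Q.natDegree ≤ D)
    (h : ∀ n, Tendsto (fun i => (P i).coeff n) l (𝓝 (Q.coeff n)))
    {z : ι → ℂ} {z₀ : ℂ} (hz : Tendsto z l (𝓝 z₀)) (n : ℕ) :
    Tendsto (fun i => (P i /ₘ (X - C (z i))).coeff n) l (𝓝 ((Q /ₘ (X - C z₀)).coeff n)) := by
  simp only [coeff_divByMonic_X_sub_C_of_natDegree_le (hP _),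
    coeff_divByMonic_X_sub_C_of_natDegree_le hQ]
  exact tendsto_finsetSum _ fun i _ => (hz.pow _).mul (h i)

lemma natDegree_divByMonic_X_sub_C_le {P : ℂ[X]} {D : ℕ} (hP : P.natDegree ≤ D) (a : ℂ) :
    (P /ₘ (X - C a)).natDegree ≤ D := by
  rw [natDegree_divByMonic _ (monic_X_sub_C a)]
  omega

lemma norm_prod_sub_le_mul_pow {z₀ z : ℂ} {r : ℝ} (hr : 0 < r) (s : Multiset ℂ)
    (hs : ∀ w ∈ s, r ≤ dist w z₀) :
    ‖(s.map fun w => z - w).prod‖ ≤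
      ‖(s.map fun w => z₀ - w).prod‖ * (1 + dist z z₀ / r) ^ Multiset.card s := by
  induction s using Multiset.induction_on with
  | empty => simp
  | cons w s ih =>
    have ih := ih fun v hv => hs v (Multiset.mem_cons_of_mem hv)
    have hw : r ≤ dist w z₀ := hs w (Multiset.mem_cons_self w s)
    have key : ‖z - w‖ ≤ ‖z₀ - w‖ * (1 + dist z z₀ / r) := by
      rw [← dist_eq_norm, ← dist_eq_norm, dist_comm z₀ w]
      have h1 : dist z w ≤ dist z z₀ + dist w z₀ := dist_triangle_right _ _ _
      have h2 : r * (dist z z₀ / r) ≤ dist w z₀ * (dist z z₀ / r) := by gcongr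
      rw [mul_div_cancel₀ _ hr.ne'] at h2
      linarith
    simp only [Multiset.map_cons, Multiset.prod_cons, Multiset.card_cons, norm_mul, pow_succ]
    calc _ ≤ (‖z₀ - w‖ * (1 + dist z z₀ / r)) * (‖(s.map fun w => z₀ - w).prod‖ *
            (1 + dist z z₀ / r) ^ Multiset.card s) := by gcongr
      _ = _ := by ring

lemma eval_eq_leadingCoeff_mul_prod (P : ℂ[X]) (z : ℂ) :
    P.eval z = P.leadingCoeff * (P.roots.map fun w => z - w).prod := by
  conv_lhs => rw [(IsAlgClosed.splits P).eq_prod_roots]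
  simp [eval_multiset_prod, Multiset.map_map]

/-- A polynomial of bounded degree without roots near `z₀` is controlled by its value at `z₀`. -/
lemma norm_eval_le_of_forall_roots {P : ℂ[X]} {D : ℕ} (hP : P.natDegree ≤ D) {z₀ : ℂ} {r : ℝ}
    (hr : 0 < r) (h : ∀ w ∈ P.roots, r ≤ dist w z₀) (z : ℂ) :
    ‖P.eval z‖ ≤ ‖P.eval z₀‖ * (1 + dist z z₀ / r) ^ D := by
  have h1 : 1 ≤ 1 + dist z z₀ / r := le_add_of_nonneg_right (by positivity)
  rw [eval_eq_leadingCoeff_mul_prod, eval_eq_leadingCoeff_mul_prod P z₀, norm_mul, norm_mul,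
    mul_assoc]
  gcongr
  refine (norm_prod_sub_le_mul_pow hr _ h).trans ?_
  gcongr
  exact (card_roots' P).trans hP

/-- Hurwitz's theorem for a single root of a polynomial. -/
lemma exists_tendsto_roots {ι : Type*} {l : Filter ι} {P : ι → ℂ[X]} {Q : ℂ[X]} {D : ℕ}
    (hP : ∀ i, (P i).natDegree ≤ D) (hQ : Q.natDegree ≤ D) (hQ0 : Q ≠ 0)
    (h : ∀ n, Tendsto (fun i => (P i).coeff n) l (𝓝 (Q.coeff n)))
    {z₀ : ℂ} (hz₀ : Q.eval z₀ = 0) :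
    ∃ z : ι → ℂ, Tendsto z l (𝓝 z₀) ∧ ∀ᶠ i in l, z i ∈ (P i).roots := by
  classical
  obtain ⟨x, hx⟩ : ∃ x, Q.eval x ≠ 0 := by
    by_contra! hx
    exact hQ0 (Polynomial.funext fun x => by simpa using hx x)
  have near : ∀ r > 0, ∀ᶠ i in l, ∃ w ∈ (P i).roots, dist w z₀ < r := by
    intro r hr
    have h0 := ((tendsto_eval_of_tendsto_coeff hP hQ h (tendsto_const_nhds (x := z₀))).norm).mul_const
      ((1 + dist x z₀ / r) ^ D)
    have h1 := (tendsto_eval_of_tendsto_coeff hP hQ h (tendsto_const_nhds (x := x))).norm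
    rw [hz₀, norm_zero, zero_mul] at h0
    filter_upwards [h0.eventually_lt h1 (norm_pos_iff.2 hx)] with i hi
    by_contra! hw
    exact hi.not_ge (norm_eval_le_of_forall_roots (hP i) hr hw x)
  have choice : ∀ i, ∃ z : ℂ, (∃ w, w ∈ (P i).roots) →
      z ∈ (P i).roots ∧ ∀ w ∈ (P i).roots, dist z z₀ ≤ dist w z₀ := by
    intro i
    by_cases hi : ∃ w, w ∈ (P i).roots
    · obtain ⟨w, hw⟩ := hi
      obtain ⟨z, hz, hz'⟩ := (P i).roots.toFinset.exists_min_image (fun z => dist z z₀)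
        ⟨w, Multiset.mem_toFinset.2 hw⟩
      exact ⟨z, fun _ => ⟨Multiset.mem_toFinset.1 hz,
        fun w hw => hz' w (Multiset.mem_toFinset.2 hw)⟩⟩
    · exact ⟨0, fun h => absurd h hi⟩
  choose z hz using choice
  refine ⟨z, Metric.tendsto_nhds.2 fun r hr => ?_, ?_⟩
  · filter_upwards [near r hr] with i ⟨w, hw, hwr⟩
    exact ((hz i ⟨w, hw⟩).2 w hw).trans_lt hwr
  · filter_upwards [near 1 one_pos] with i ⟨w, hw, _⟩
    exact (hz i ⟨w, hw⟩).1

open scoped Classical in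
lemma card_filter_roots_eq_add_one {P : ℂ[X]} {S : Set ℂ} {z : ℂ} (hz : z ∈ P.roots)
    (hzS : z ∈ S) :
    Multiset.card (P.roots.filter (· ∈ S)) =
      Multiset.card ((P /ₘ (X - C z)).roots.filter (· ∈ S)) + 1 := by
  have hP : (X - C z) * (P /ₘ (X - C z)) = P :=
    mul_divByMonic_eq_iff_isRoot.2 (isRoot_of_mem_roots hz)
  have h0 : (X - C z) * (P /ₘ (X - C z)) ≠ 0 := hP.symm ▸ (mem_roots'.1 hz).1
  conv_lhs => rw [← hP, roots_mul h0, roots_X_sub_C]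
  simp [hzS, add_comm]

lemma divByMonic_X_sub_C_ne_zero {P : ℂ[X]} (hP : P ≠ 0) {z : ℂ} (hz : P.IsRoot z) :
    P /ₘ (X - C z) ≠ 0 := fun h =>
  hP (by rw [← mul_divByMonic_eq_iff_isRoot.2 hz, h, mul_zero])

open scoped Classical in
/-- The number of roots in an open set is lower semicontinuous. -/
lemma eventually_le_card_filter_roots {ι : Type*} {l : Filter ι} {D : ℕ} {U : Set ℂ}
    (hU : IsOpen U) (M : ℕ) {P : ι → ℂ[X]} {Q : ℂ[X]}
    (hP : ∀ i, (P i).natDegree ≤ D) (hQ : Q.natDegree ≤ D) (hQ0 : Q ≠ 0)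
    (h : ∀ n, Tendsto (fun i => (P i).coeff n) l (𝓝 (Q.coeff n)))
    (hM : M ≤ Multiset.card (Q.roots.filter (· ∈ U))) :
    ∀ᶠ i in l, M ≤ Multiset.card ((P i).roots.filter (· ∈ U)) := by
  induction M generalizing P Q with
  | zero => simp
  | succ M ih =>
    obtain ⟨z₀, hz₀⟩ := Multiset.card_pos_iff_exists_mem.1 (Nat.succ_pos M |>.trans_le hM)
    obtain ⟨hz₀, hz₀U⟩ := Multiset.mem_filter.1 hz₀
    obtain ⟨z, hz, hzP⟩ := exists_tendsto_roots hP hQ hQ0 h (isRoot_of_mem_roots hz₀)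
    rw [card_filter_roots_eq_add_one hz₀ hz₀U] at hM
    have := ih (fun i => natDegree_divByMonic_X_sub_C_le (hP i) (z i))
      (natDegree_divByMonic_X_sub_C_le hQ z₀)
      (divByMonic_X_sub_C_ne_zero hQ0 (isRoot_of_mem_roots hz₀))
      (tendsto_coeff_divByMonic_X_sub_C hP hQ h hz) (by omega)
    filter_upwards [this, hzP, hz (hU.mem_nhds hz₀U)] with i hi hiP hiU
    rw [card_filter_roots_eq_add_one hiP (show z i ∈ U from hiU)]
    omega

open scoped Classical in
/-- The number of roots in a compact set is upper semicontinuous. -/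
lemma le_card_filter_roots_of_eventually {ι : Type*} {l : Ultrafilter ι} {D : ℕ} {S : Set ℂ}
    (hS : IsCompact S) (M : ℕ) {P : ι → ℂ[X]} {Q : ℂ[X]}
    (hP : ∀ i, (P i).natDegree ≤ D) (hQ : Q.natDegree ≤ D) (hQ0 : Q ≠ 0)
    (h : ∀ n, Tendsto (fun i => (P i).coeff n) l (𝓝 (Q.coeff n)))
    (hM : ∀ᶠ i in l, M ≤ Multiset.card ((P i).roots.filter (· ∈ S))) :
    M ≤ Multiset.card (Q.roots.filter (· ∈ S)) := by
  induction M generalizing P Q with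
  | zero => simp
  | succ M ih =>
    have choice : ∀ i, ∃ z : ℂ, M + 1 ≤ Multiset.card ((P i).roots.filter (· ∈ S)) →
        z ∈ (P i).roots ∧ z ∈ S := by
      intro i
      by_cases hi : M + 1 ≤ Multiset.card ((P i).roots.filter (· ∈ S))
      · obtain ⟨z, hz⟩ := Multiset.card_pos_iff_exists_mem.1 (Nat.succ_pos M |>.trans_le hi)
        exact ⟨z, fun _ => Multiset.mem_filter.1 hz⟩
      · exact ⟨0, fun h => absurd h hi⟩
    choose z hz using choice
    have hzP : ∀ᶠ i in l, z i ∈ (P i).roots ∧ z i ∈ S := hM.mono hz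
    obtain ⟨z₀, hz₀S, hz₀⟩ := hS.ultrafilter_le_nhds (l.map z)
      (le_principal_iff.2 (hzP.mono fun i hi => hi.2))
    have hz₀ : Tendsto z l (𝓝 z₀) := hz₀
    have hroot : Q.eval z₀ = 0 := by
      refine tendsto_nhds_unique (tendsto_eval_of_tendsto_coeff hP hQ h hz₀)
        (tendsto_const_nhds.congr' ?_)
      filter_upwards [hzP] with i hi using (isRoot_of_mem_roots hi.1).symm
    rw [card_filter_roots_eq_add_one ((mem_roots hQ0).2 hroot) hz₀S]
    refine Nat.succ_le_succ (ih (fun i => natDegree_divByMonic_X_sub_C_le (hP i) (z i))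
      (natDegree_divByMonic_X_sub_C_le hQ z₀) (divByMonic_X_sub_C_ne_zero hQ0 hroot)
      (tendsto_coeff_divByMonic_X_sub_C hP hQ h hz₀) ?_)
    filter_upwards [hM, hzP] with i hi hiz
    rw [card_filter_roots_eq_add_one hiz.1 hiz.2] at hi
    omega

open scoped Classical in
/-- If no member of the segment of polynomials `A + t B`, `t ∈ [0, 1]`, has a root in `S \ U`,
then `A + B` has at least as many roots in `S` as `A`. -/
lemma card_filter_roots_le_of_segment {A B : ℂ[X]} {U S : Set ℂ} (hU : IsOpen U)
    (hS : IsCompact S) (hUS : U ⊆ S) (hne : (S \ U).Nonempty)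
    (h : ∀ t ∈ Set.Icc (0 : ℝ) 1, ∀ z ∈ S \ U, A.eval z + t * B.eval z ≠ 0) :
    Multiset.card (A.roots.filter (· ∈ S)) ≤ Multiset.card ((A + B).roots.filter (· ∈ S)) := by
  set P : unitInterval → ℂ[X] := fun t => A + C ((t : ℝ) : ℂ) * B with hPdef
  have hP : ∀ t, ∀ z ∈ S \ U, (P t).eval z ≠ 0 := fun t z hz => by
    simpa [P] using h t t.2 z hz
  have hP0 : ∀ t, P t ≠ 0 := fun t h0 => by
    obtain ⟨z, hz⟩ := hne
    exact hP t z hz (by simp [h0])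
  have hdeg : ∀ t, (P t).natDegree ≤ max A.natDegree B.natDegree := fun t =>
    (natDegree_add_le _ _).trans (max_le_max le_rfl (natDegree_C_mul_le _ _))
  have hcont : ∀ n, Continuous fun t => (P t).coeff n := fun n => by
    simp only [P, coeff_add, coeff_C_mul]
    fun_prop
  have hcard : ∀ t, (P t).roots.filter (· ∈ S) = (P t).roots.filter (· ∈ U) := fun t =>
    Multiset.filter_congr fun z hz => ⟨fun hzS => by
      by_contra hzU
      exact hP t z ⟨hzS, hzU⟩ (isRoot_of_mem_roots hz), fun hzU => hUS hzU⟩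
  set M := Multiset.card (A.roots.filter (· ∈ S))
  have hclopen : IsClopen {t | M ≤ Multiset.card ((P t).roots.filter (· ∈ S))} := by
    constructor
    · refine isClosed_iff_ultrafilter.2 fun t u hu hmem => ?_
      exact le_card_filter_roots_of_eventually hS M hdeg (hdeg t) (hP0 t)
        (fun n => ((hcont n).tendsto t).mono_left hu) hmem
    · refine isOpen_iff_ultrafilter.2 fun t ht u hu => ?_
      simp only [hcard, Set.mem_ofPred_eq] at ht ⊢
      exact eventually_le_card_filter_roots hU M hdeg (hdeg t) (hP0 t)
        (fun n => ((hcont n).tendsto t).mono_left hu) ht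
  have h1 := hclopen.eq_univ ⟨0, by simp [P, M]⟩
  have h2 : (1 : unitInterval) ∈ {t | M ≤ Multiset.card ((P t).roots.filter (· ∈ S))} := by
    rw [h1]; trivial
  simpa [P] using h2

/-- A point outside a bounded convex set is separated from it, with a quantitative lower bound for
the reciprocals `1 / (z - w)`. -/
lemma exists_le_re_mul_one_div {K : Set ℂ} (hconv : Convex ℝ K) (hbd : IsBounded K)
    (hne : K.Nonempty) {z : ℂ} (hz : 0 < infDist z K) :
    ∃ u : ℂ, ‖u‖ = infDist z K ∧
      ∀ w ∈ K, infDist z K ^ 2 / (diam K + infDist z K) ^ 2 ≤ (u * (1 / (z - w))).re := by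
  obtain ⟨y, hy, hzy⟩ := exists_norm_eq_iInf_of_complete_convex hne.closure
    isClosed_closure.isComplete hconv.closure z
  have hmin : ‖z - y‖ = infDist z K := by
    rw [hzy, ← infDist_closure, infDist_eq_iInf]
    simp only [dist_eq_norm]
  rw [norm_eq_iInf_iff_real_inner_le_zero hconv.closure hy] at hzy
  refine ⟨z - y, hmin, fun w hw => ?_⟩
  set δ := infDist z K
  have h1 : δ ≤ ‖z - w‖ := by rw [← dist_eq_norm]; exact infDist_le_dist_of_mem hw
  have h2 : ‖z - w‖ ≤ diam K + δ := by
    rw [← dist_eq_norm, add_comm]; exact dist_le_infDist_add_diam hbd hw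
  have h3 : ((z - y) * (1 / (z - w))).re = inner ℝ (z - y) (z - w) / ‖z - w‖ ^ 2 := by
    rw [Complex.inner, Complex.sq_norm, one_div, Complex.mul_re, Complex.inv_re, Complex.inv_im,
      Complex.mul_re, Complex.conj_re, Complex.conj_im]
    ring
  have h4 : δ ^ 2 ≤ inner ℝ (z - y) (z - w) := by
    have : z - w = (z - y) - (w - y) := by ring
    rw [this, inner_sub_right, real_inner_self_eq_norm_sq, hmin]
    linarith [hzy w (subset_closure hw)]
  have h5 : 0 < ‖z - w‖ := hz.trans_le h1
  rw [h3]
  have h6 := (sq_nonneg δ).trans h4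
  gcongr

lemma card_mul_le_norm_sum_one_div {K : Set ℂ} (hconv : Convex ℝ K) (hbd : IsBounded K)
    (hne : K.Nonempty) {z : ℂ} (hz : 0 < infDist z K) (R : Multiset ℂ) (hR : ∀ w ∈ R, w ∈ K) :
    Multiset.card R * infDist z K / (diam K + infDist z K) ^ 2 ≤
      ‖(R.map fun w => 1 / (z - w)).sum‖ := by
  obtain ⟨u, hu, h⟩ := exists_le_re_mul_one_div hconv hbd hne hz
  set c := infDist z K ^ 2 / (diam K + infDist z K) ^ 2 with hc
  have key : Multiset.card R * c ≤ (u * (R.map fun w => 1 / (z - w)).sum).re := by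
    induction R using Multiset.induction_on with
    | empty => simp
    | cons w R ih =>
      have h1 := ih fun v hv => hR v (Multiset.mem_cons_of_mem hv)
      have h2 := h w (hR w (Multiset.mem_cons_self w R))
      rw [Multiset.card_cons, Multiset.map_cons, Multiset.sum_cons, mul_add, Complex.add_re]
      push_cast
      linarith
  have h1 := key.trans ((Complex.re_le_norm _).trans (norm_mul_le _ _))
  rw [hu] at h1
  refine le_of_mul_le_mul_left (le_trans (le_of_eq ?_) h1) hz
  rw [hc]
  ring

lemma norm_sum_one_div_le {z : ℂ} {ρ : ℝ} (hρ : 0 < ρ) (R : Multiset ℂ)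
    (hR : ∀ w ∈ R, ρ ≤ dist z w) :
    ‖(R.map fun w => 1 / (z - w)).sum‖ ≤ Multiset.card R / ρ := by
  induction R using Multiset.induction_on with
  | empty => simp
  | cons w R ih =>
    have h1 := ih fun v hv => hR v (Multiset.mem_cons_of_mem hv)
    have h2 : ‖1 / (z - w)‖ ≤ 1 / ρ := by
      rw [norm_div, norm_one, ← dist_eq_norm]
      exact one_div_le_one_div_of_le hρ (hR w (Multiset.mem_cons_self w R))
    rw [Multiset.card_cons, Multiset.map_cons, Multiset.sum_cons]
    refine (norm_add_le _ _).trans ?_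
    push_cast
    rw [add_div]
    linarith

lemma exists_forall_le_abs_sub {m : ℕ} (hm : 0 < m) {ε : ℝ} (hε : 0 < ε) (ds : Multiset ℝ)
    (hds : Multiset.card ds ≤ m) :
    ∃ δ, ε / 2 ≤ δ ∧ δ ≤ ε ∧ ∀ d ∈ ds, ε / (4 * m) ≤ |δ - d| := by
  classical
  have hm' : (0 : ℝ) < m := Nat.cast_pos.2 hm
  by_contra! H
  have hex : ∀ i ∈ Finset.range (m + 1), ∃ d ∈ ds.toFinset,
      |ε / 2 + i * (ε / (2 * m)) - d| < ε / (4 * m) := by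
    intro i hi
    have hi : (i : ℝ) ≤ m := Nat.cast_le.2 (Nat.lt_succ_iff.1 (Finset.mem_range.1 hi))
    obtain ⟨d, hd, hd'⟩ := H (ε / 2 + i * (ε / (2 * m))) (le_add_of_nonneg_right (by positivity))
      (by
        have : (i : ℝ) * (ε / (2 * m)) ≤ m * (ε / (2 * m)) := by gcongr
        have h2 : (m : ℝ) * (ε / (2 * m)) = ε / 2 := by field_simp
        linarith)
    exact ⟨d, Multiset.mem_toFinset.2 hd, hd'⟩
  choose! f hf hfd using hex
  obtain ⟨i, hi, j, hj, hij, hfij⟩ := Finset.exists_ne_map_eq_of_card_lt_of_maps_to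
    (s := Finset.range (m + 1)) (t := ds.toFinset)
    (by simpa using (Multiset.toFinset_card_le ds).trans_lt (Nat.lt_succ_of_le hds)) hf
  have h1 := hfd i hi
  have h2 := hfd j hj
  rw [hfij] at h1
  have h3 : |((i : ℝ) - j) * (ε / (2 * m))| < ε / (2 * m) := by
    have := abs_sub_lt_iff.1 (lt_of_le_of_lt (abs_sub _ _) (add_lt_add h1 h2))
    have h4 : ε / (4 * m) + ε / (4 * m) = ε / (2 * m) := by field_simp; norm_num
    rw [abs_lt]
    constructor <;> linarith [this.1, this.2]
  rw [abs_mul, abs_of_pos (by positivity : 0 < ε / (2 * m))] at h3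
  have h5 : |((i : ℝ) - j)| < 1 := by
    by_contra! h
    exact h3.not_ge (le_mul_of_one_le_left (by positivity) h)
  have h6 : |((i : ℤ) - j)| < 1 := by exact_mod_cast h5
  rw [Int.abs_lt_one_iff] at h6
  omega

lemma exists_infDist_eq {K : Set ℂ} (hbd : IsBounded K) (hne : K.Nonempty) {δ : ℝ} (hδ : 0 ≤ δ) :
    ∃ z, infDist z K = δ := by
  obtain ⟨x, hx⟩ := hne
  refine mem_range_of_exists_le_of_exists_ge (continuous_infDist_pt K)
    ⟨x, by rwa [infDist_zero_of_mem hx]⟩ ⟨x + (δ + diam K : ℝ), ?_⟩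
  have h := dist_le_infDist_add_diam hbd hx (x := x + (δ + diam K : ℝ))
  rw [dist_eq_norm, add_sub_cancel_left, Complex.norm_real, Real.norm_of_nonneg
    (add_nonneg hδ diam_nonneg)] at h
  linarith

open scoped Classical in
/-- Gauss–Lucas, counting critical points with multiplicity. -/
lemma card_filter_roots_derivative {K : Set ℂ} (hconv : Convex ℝ K) {g : ℂ[X]}
    (hdeg : 0 < g.natDegree) (hg : ∀ w ∈ g.roots, w ∈ K) :
    Multiset.card (g.derivative.roots.filter (· ∈ K)) = g.natDegree - 1 := by
  rw [Multiset.filter_eq_self.2, ← (IsAlgClosed.splits _).natDegree_eq_card_roots,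
    natDegree_derivative]
  intro z hz
  have hz' : z ∈ g.derivative.rootSet ℂ := by
    simpa [rootSet, aroots] using hz
  refine convexHull_min (fun w hw => hg w ?_) hconv
    (rootSet_derivative_subset_convexHull_rootSet (natDegree_pos_iff_degree_pos.1 hdeg) hz')
  simpa [rootSet, aroots] using hw

/-- The logarithmic derivative of `g` dominates that of `a / q`, so the numerator of
`g' / g + t (a / q)' / (a / q)` does not vanish. -/
lemma eval_add_mul_eval_ne_zero {g a q : ℂ[X]} {z : ℂ} (hg : g.eval z ≠ 0) (ha : a.eval z ≠ 0)
    (hq : q.eval z ≠ 0)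
    (h : ‖(a.roots.map fun w => 1 / (z - w)).sum‖ + ‖(q.roots.map fun w => 1 / (z - w)).sum‖ <
      ‖(g.roots.map fun w => 1 / (z - w)).sum‖) {t : ℝ} (ht : t ∈ Set.Icc (0 : ℝ) 1) :
    (g.derivative * (a * q)).eval z +
      t * (g * (a.derivative * q - a * q.derivative)).eval z ≠ 0 := by
  intro h0
  simp only [eval_mul, eval_sub, (IsAlgClosed.splits g).eval_derivative_eq_eval_mul_sum hg,
    (IsAlgClosed.splits a).eval_derivative_eq_eval_mul_sum ha,
    (IsAlgClosed.splits q).eval_derivative_eq_eval_mul_sum hq] at h0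
  set G := (g.roots.map fun w => 1 / (z - w)).sum
  set A := (a.roots.map fun w => 1 / (z - w)).sum
  set Q := (q.roots.map fun w => 1 / (z - w)).sum
  have h1 : (g.eval z * a.eval z * q.eval z) * (G + t * (A - Q)) = 0 := by
    rw [← h0]; ring
  have h2 : G = -(t * (A - Q)) :=
    eq_neg_of_add_eq_zero_left ((mul_eq_zero.1 h1).resolve_left (mul_ne_zero (mul_ne_zero hg ha) hq))
  have h3 : ‖G‖ ≤ ‖A‖ + ‖Q‖ := by
    rw [h2, norm_neg, norm_mul, Complex.norm_real, Real.norm_of_nonneg ht.1]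
    exact (mul_le_of_le_one_left (norm_nonneg _) ht.2).trans (norm_sub_le _ _)
  exact h3.not_gt h

open scoped Classical in
/-- Main theorem, general convex case: if `16(s+ε)²/ε² < k/(n-k)²` then every
rational function `f = p/q` (in lowest terms) with at most `n` zeros and poles
combined and at least `k` zeros in `K` has at least `k-1` critical points in
the closed `ε`-neighborhood of `K`. -/
theorem stmt_7 (K : Set ℂ) (hconv : Convex ℝ K) (hbd : IsBounded K)
    (s : ℝ) (hs : s = diam K) (n k : ℕ) (hk : 0 < k) (hkn : k < n)
    (ε : ℝ) (hε : 0 < ε)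
    (hineq : 16 * (s + ε) ^ 2 / ε ^ 2 < (k : ℝ) / ((n : ℝ) - k) ^ 2)
    (p q : ℂ[X]) (hp : p ≠ 0) (hq : q ≠ 0) (hco : IsCoprime p q)
    (hn : Multiset.card p.roots + Multiset.card q.roots ≤ n)
    (hkK : k ≤ Multiset.card (p.roots.filter (· ∈ K))) :
    k - 1 ≤ Multiset.card
      (((q * p.derivative - p * q.derivative).roots).filter
        (fun z => infDist z K ≤ ε)) := by
  subst hs
  have hs0 : 0 ≤ diam K := diam_nonneg
  obtain ⟨x, hx⟩ := Multiset.card_pos_iff_exists_mem.1 (hk.trans_le hkK)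
  have hne : K.Nonempty := ⟨x, (Multiset.mem_filter.1 hx).2⟩
  -- split off the zeros in `K`
  set R := p.roots.filter (· ∈ K) with hR
  set R' := p.roots.filter (¬ · ∈ K)
  have hRR' : R + R' = p.roots := Multiset.filter_add_not _ _
  set g : ℂ[X] := (R.map fun w => X - C w).prod with hg
  set a : ℂ[X] := C p.leadingCoeff * (R'.map fun w => X - C w).prod with ha
  have hga : p = g * a := by
    rw [(IsAlgClosed.splits p).eq_prod_roots, ← hRR', Multiset.map_add, Multiset.prod_add]
    ring
  have hg0 : g ≠ 0 := left_ne_zero_of_mul (hga ▸ hp)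
  have ha0 : a ≠ 0 := right_ne_zero_of_mul (hga ▸ hp)
  have hgroots : g.roots = R := roots_multiset_prod_X_sub_C R
  have haroots : a.roots = R' := by
    rw [ha, roots_C_mul _ (leadingCoeff_ne_zero.2 hp), roots_multiset_prod_X_sub_C]
  clear_value g a
  have hgdeg : g.natDegree = Multiset.card R := by
    rw [(IsAlgClosed.splits g).natDegree_eq_card_roots, hgroots]
  -- choose a level avoiding the other zeros and the poles
  obtain ⟨m, rfl⟩ : ∃ m, n = k + m := ⟨n - k, by omega⟩
  have hm : 0 < m := by omega
  have hm' : (0 : ℝ) < m := Nat.cast_pos.2 hm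
  have hcard : Multiset.card (R' + q.roots) ≤ m := by
    have := congrArg Multiset.card hRR'
    rw [Multiset.card_add] at this ⊢
    omega
  obtain ⟨δ, hδ1, hδ2, hδ⟩ := exists_forall_le_abs_sub hm hε ((R' + q.roots).map (infDist · K))
    (by rwa [Multiset.card_map])
  have hδ0 : 0 < δ := by linarith
  set ρ := ε / (4 * m) with hρ
  have hρ0 : 0 < ρ := by positivity
  have hnum : m / ρ < Multiset.card R * δ / (diam K + δ) ^ 2 := by
    have h1 : 16 * (diam K + ε) ^ 2 * m ^ 2 < k * ε ^ 2 := by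
      rw [div_lt_div_iff₀ (by positivity) (by push_cast; simpa using by positivity)] at hineq
      simpa using hineq
    have h2 : m / ρ < k * (ε / 2) / (diam K + ε) ^ 2 := by
      have : m / ρ = 4 * m ^ 2 / ε := by rw [hρ]; field_simp
      rw [this, div_lt_div_iff₀ hε (by positivity)]
      have : 0 < (diam K + ε) ^ 2 * (m : ℝ) ^ 2 := by positivity
      nlinarith
    refine h2.trans_le ?_
    gcongr
  have hfar : ∀ z, infDist z K = δ → ∀ w ∈ R' + q.roots, ρ ≤ dist z w := by
    intro z hz w hw
    refine (hδ _ (Multiset.mem_map_of_mem _ hw)).trans ?_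
    rw [← hz, abs_le]
    have h1 := infDist_le_infDist_add_dist (s := K) (x := z) (y := w)
    have h2 := infDist_le_infDist_add_dist (s := K) (x := w) (y := z)
    rw [dist_comm w z] at h2
    constructor <;> linarith
  have heval : ∀ {f : ℂ[X]} {z : ℂ}, f ≠ 0 → z ∉ f.roots → f.eval z ≠ 0 := fun hf hz h =>
    hz ((mem_roots hf).2 h)
  have hnot : ∀ z, infDist z K = δ → z ∉ R' + q.roots := fun z hz hz' => by
    have := hfar z hz z hz'
    rw [dist_self] at this
    exact this.not_gt hρ0
  -- compare with the critical points of `g`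
  have hseg := card_filter_roots_le_of_segment (A := g.derivative * (a * q))
    (B := g * (a.derivative * q - a * q.derivative))
    (U := {z | infDist z K < δ}) (S := {z | infDist z K ≤ δ})
    (isOpen_lt (continuous_infDist_pt K) continuous_const)
    (isCompact_of_isClosed_isBounded (isClosed_le (continuous_infDist_pt K) continuous_const)
      ((hbd.thickening (δ := δ + 1)).subset fun z hz =>
        (mem_thickening_iff_infDist_lt hne).2 (lt_of_le_of_lt hz (lt_add_one δ))))
    (Set.ofPred_subset_ofPred.2 fun z hz => hz.le)
    (by
      obtain ⟨z, hz⟩ := exists_infDist_eq hbd hne hδ0.le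
      exact ⟨z, hz.le, fun h => (ne_of_lt h) hz⟩)
    (by
      rintro t ht z ⟨hz1, hz2⟩
      have hz : infDist z K = δ := le_antisymm hz1 (not_lt.1 hz2)
      have hzn := hnot z hz
      rw [Multiset.mem_add, not_or] at hzn
      have hzR : z ∉ g.roots := fun hzg => by
        rw [hgroots, hR] at hzg
        rw [infDist_zero_of_mem (Multiset.mem_filter.1 hzg).2] at hz
        exact hδ0.ne hz
      refine eval_add_mul_eval_ne_zero (heval hg0 hzR) (heval ha0 (haroots ▸ hzn.1))
        (heval hq hzn.2) ?_ ht
      rw [hgroots, haroots]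
      have h1 := norm_sum_one_div_le hρ0 R' fun w hw =>
        hfar z hz w (Multiset.mem_add.2 (Or.inl hw))
      have h2 := norm_sum_one_div_le hρ0 q.roots fun w hw =>
        hfar z hz w (Multiset.mem_add.2 (Or.inr hw))
      have h3 := card_mul_le_norm_sum_one_div hconv hbd hne (z := z) (hz ▸ hδ0) R
        fun w hw => (Multiset.mem_filter.1 hw).2
      rw [hz] at h3
      have h4 : (Multiset.card R' : ℝ) / ρ + Multiset.card q.roots / ρ ≤ m / ρ := by
        rw [← add_div]
        gcongr
        rw [Multiset.card_add] at hcard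
        exact_mod_cast hcard
      linarith)
  have hsum : g.derivative * (a * q) + g * (a.derivative * q - a * q.derivative) =
      q * p.derivative - p * q.derivative := by
    rw [hga, derivative_mul]
    ring
  rw [hsum] at hseg
  have hg'0 : g.derivative ≠ 0 := fun h => by
    have := derivative_eq_zero.1 h
    omega
  have hGL := card_filter_roots_derivative hconv (g := g) (by omega) fun w hw => by
    rw [hgroots] at hw
    exact (Multiset.mem_filter.1 hw).2
  calc k - 1 ≤ Multiset.card (g.derivative.roots.filter (· ∈ K)) := by omega
    _ ≤ Multiset.card (g.derivative.roots.filter (· ∈ {z | infDist z K ≤ δ})) :=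
      Multiset.card_le_card (Multiset.monotone_filter_right _ fun z hz => by
        simpa [infDist_zero_of_mem hz] using hδ0.le)
    _ ≤ Multiset.card ((g.derivative * (a * q)).roots.filter (· ∈ {z | infDist z K ≤ δ})) := by
      rw [roots_mul (mul_ne_zero hg'0 (mul_ne_zero ha0 hq)), Multiset.filter_add,
        Multiset.card_add]
      exact Nat.le_add_right _ _
    _ ≤ _ := hseg
    _ ≤ _ := Multiset.card_le_card (Multiset.monotone_filter_right _ fun z hz => le_trans hz hδ2)
end

section
/- Let K ⊂ ℂ be a closed disk of diameter s, let n > k be positive integers, and ε > 0 with 8(s+ε)/ε < k/(n-k)². Then every rational function f with at most n zeros and poles combined (with multiplicity) and at least k zeros (with multiplicity) lying in K has at least k - 1 critical points (with multiplicity) in the ε-neighborhood of K. -/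
open Polynomial Metric

open scoped Classical in
/-- The integral of `∑ 1 / (z - a)` over a circle avoiding the points `a` counts the points
inside the circle. -/
lemma circleIntegral_sum_one_div_sub {c : ℂ} {r : ℝ} (hr : 0 < r) (S : Multiset ℂ)
    (hS : ∀ a ∈ S, a ∉ sphere c r) :
    CircleIntegrable (fun z => (S.map fun a => 1 / (z - a)).sum) c r ∧
      (∮ z in C(c, r), (S.map fun a => 1 / (z - a)).sum) =
        2 * Real.pi * Complex.I * Multiset.card (S.filter (· ∈ ball c r)) := by
  induction S using Multiset.induction_on with
  | empty => simp [circleIntegral]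
  | cons a S ih =>
    obtain ⟨hi, he⟩ := ih fun b hb => hS b (Multiset.mem_cons_of_mem hb)
    have ha : a ∉ sphere c r := hS a (Multiset.mem_cons_self a S)
    have hai : CircleIntegrable (fun z => (z - a)⁻¹) c r := by
      rw [circleIntegrable_sub_inv_iff, abs_of_pos hr]
      exact Or.inr ha
    simp only [Multiset.map_cons, Multiset.sum_cons, one_div] at hi he ⊢
    refine ⟨hai.add hi, ?_⟩
    rw [circleIntegral.integral_add hai hi, he]
    by_cases hab : a ∈ ball c r
    · rw [circleIntegral.integral_sub_inv_of_mem_ball hab, Multiset.filter_cons_of_pos _ hab]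
      push_cast [Multiset.card_cons]
      ring
    · rw [Multiset.filter_cons_of_neg _ hab]
      have hac : a ∉ closedBall c r := by
        simp only [mem_ball, mem_closedBall, mem_sphere, not_lt, not_le] at *
        exact lt_of_le_of_ne hab (Ne.symm ha)
      have hne : ∀ z ∈ closedBall c r, z - a ≠ 0 := fun z hz h =>
        hac (sub_eq_zero.1 h ▸ hz)
      rw [Complex.circleIntegral_eq_zero_of_differentiable_on_off_countable hr.le
        Set.countable_empty, zero_add]
      · exact ContinuousOn.inv₀ (by fun_prop) hne
      · intro z hz
        exact DifferentiableAt.inv (by fun_prop) (hne z (ball_subset_closedBall hz.1))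

open scoped Classical in
/-- The argument principle for a polynomial and a circle. -/
lemma circleIntegral_derivative_div {c : ℂ} {r : ℝ} (hr : 0 < r) {p : ℂ[X]}
    (hp : ∀ z ∈ sphere c r, p.eval z ≠ 0) :
    CircleIntegrable (fun z => p.derivative.eval z / p.eval z) c r ∧
      (∮ z in C(c, r), p.derivative.eval z / p.eval z) =
        2 * Real.pi * Complex.I * Multiset.card (p.roots.filter (· ∈ ball c r)) := by
  have h := circleIntegral_sum_one_div_sub hr p.roots
    fun a ha hs => hp a hs (isRoot_of_mem_roots ha)
  have heq : Set.EqOn (fun z => p.derivative.eval z / p.eval z)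
      (fun z => (p.roots.map fun a => 1 / (z - a)).sum) (sphere c r) := fun z hz =>
    (IsAlgClosed.splits p).eval_derivative_div_eval_of_ne_zero (hp z hz)
  refine ⟨?_, (circleIntegral.integral_congr hr.le heq).trans h.2⟩
  exact ContinuousOn.circleIntegrable hr.le
    (ContinuousOn.div (by fun_prop) (by fun_prop) hp)

open scoped Classical in
/-- A form of Rouché's theorem for polynomials: if the quotient of two polynomials has positive
real part on a circle, they have equally many roots inside it. -/
lemma card_roots_ball_eq_of_re_div_pos {c : ℂ} {r : ℝ} (hr : 0 < r) {p q : ℂ[X]}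
    (h : ∀ z ∈ sphere c r, 0 < (p.eval z / q.eval z).re) :
    Multiset.card (p.roots.filter (· ∈ ball c r)) =
      Multiset.card (q.roots.filter (· ∈ ball c r)) := by
  have hp : ∀ z ∈ sphere c r, p.eval z ≠ 0 := fun z hz h0 => by simpa [h0] using h z hz
  have hq : ∀ z ∈ sphere c r, q.eval z ≠ 0 := fun z hz h0 => by simpa [h0] using h z hz
  obtain ⟨hpi, hpe⟩ := circleIntegral_derivative_div hr hp
  obtain ⟨hqi, hqe⟩ := circleIntegral_derivative_div hr hq
  have key : (∮ z in C(c, r),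
      (p.derivative.eval z / p.eval z - q.derivative.eval z / q.eval z)) = 0 := by
    refine circleIntegral.integral_eq_zero_of_hasDerivWithinAt
      (f := fun z => Complex.log (p.eval z / q.eval z)) hr.le fun z hz => ?_
    have hd := (((p.hasDerivAt z).div (q.hasDerivAt z) (hq z hz)).clog
      (Or.inl (h z hz))).hasDerivWithinAt (s := sphere c r)
    refine hd.congr_deriv ?_
    have h1 := hp z hz
    have h2 := hq z hz
    change _ / (p.eval z / q.eval z) = _
    field_simp
  rw [circleIntegral.integral_sub hpi hqi, hpe, hqe, ← mul_sub] at key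
  have h2 : (2 * Real.pi * Complex.I : ℂ) ≠ 0 := Complex.two_pi_I_ne_zero
  have := sub_eq_zero.1 ((mul_eq_zero.1 key).resolve_left h2)
  exact_mod_cast this

/-- An interval of length `ε` contains a point at distance at least `ε / (2 * (m + 1))` from each
of `m` given reals. -/
lemma exists_mem_Ioo_forall_le_abs_sub (a : ℝ) {ε : ℝ} (hε : 0 < ε) (S : Multiset ℝ) {m : ℕ}
    (hS : Multiset.card S ≤ m) :
    ∃ r ∈ Set.Ioo a (a + ε), ∀ x ∈ S, ε / (2 * (m + 1)) ≤ |r - x| := by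
  set δ : ℝ := ε / (2 * (m + 1)) with hδ
  have hδ0 : 0 < δ := by positivity
  have hεδ : ε = 2 * (m + 1) * δ := by rw [hδ]; field_simp
  by_contra! hcon
  have hmem : ∀ i : Fin (m + 1), a + (2 * (i : ℕ) + 1) * δ ∈ Set.Ioo a (a + ε) := by
    intro i
    have hi : ((i : ℕ) : ℝ) ≤ m := by exact_mod_cast Nat.lt_succ_iff.1 i.2
    constructor
    · have : 0 < (2 * ((i : ℕ) : ℝ) + 1) * δ := by positivity
      linarith
    · rw [hεδ]
      nlinarith
  choose x hxS hx using fun i => hcon _ (hmem i)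
  have hinj : Function.Injective x := by
    intro i j hij
    have h1 := abs_lt.1 (hx i)
    have h2 := abs_lt.1 (hx j)
    rw [hij] at h1
    have h3 : (2 * ((i : ℕ) : ℝ)) * δ < (2 * ((j : ℕ) : ℝ) + 2) * δ := by linarith [h1.2, h2.1]
    have h4 : (2 * ((j : ℕ) : ℝ)) * δ < (2 * ((i : ℕ) : ℝ) + 2) * δ := by linarith [h1.1, h2.2]
    have h5 := lt_of_mul_lt_mul_right h3 hδ0.le
    have h6 := lt_of_mul_lt_mul_right h4 hδ0.le
    have h7 : 2 * (i : ℕ) < 2 * (j : ℕ) + 2 := by exact_mod_cast h5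
    have h8 : 2 * (j : ℕ) < 2 * (i : ℕ) + 2 := by exact_mod_cast h6
    exact Fin.ext (by omega)
  have hcard := Finset.card_le_card_of_injOn (s := Finset.univ) (t := S.toFinset) x
    (fun i _ => by simpa using hxS i) hinj.injOn
  have := S.toFinset_card_le
  simp only [Finset.card_univ, Fintype.card_fin] at hcard
  omega

/-- A lower bound for `Re (u / (u - v))` when `v` lies in a disk inside the circle through `u`. -/
lemma div_add_le_re_div_sub {r R : ℝ} (hr : 0 < r) (hRr : R < r) {u v : ℂ} (hu : ‖u‖ = r)
    (hv : ‖v‖ ≤ R) : r / (r + R) ≤ (u / (u - v)).re := by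
  have hR : 0 ≤ R := (norm_nonneg v).trans hv
  have hne : u - v ≠ 0 := by
    intro h
    rw [sub_eq_zero.1 h] at hu
    linarith
  have hpos : 0 < Complex.normSq (u - v) := Complex.normSq_pos.2 hne
  have hu2 : u.re * u.re + u.im * u.im = r ^ 2 := by
    rw [← hu, ← Complex.normSq_eq_norm_sq, Complex.normSq_apply]
  have hv2 : v.re * v.re + v.im * v.im ≤ R ^ 2 := by
    rw [← Complex.normSq_apply, Complex.normSq_eq_norm_sq]
    gcongr
  have hinner : -(r * R) ≤ u.re * v.re + u.im * v.im := by
    refine (abs_le.1 (abs_le_of_sq_le_sq ?_ (by positivity))).1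
    nlinarith [sq_nonneg (u.re * v.im - u.im * v.re), sq_nonneg r]
  rw [Complex.div_re, ← add_div, div_le_div_iff₀ (by linarith) hpos, Complex.normSq_apply]
  simp only [Complex.sub_re, Complex.sub_im]
  nlinarith

lemma Multiset.re_sum_map (S : Multiset ℂ) (f : ℂ → ℂ) :
    (S.map f).sum.re = (S.map fun a => (f a).re).sum := by
  induction S using Multiset.induction_on with
  | empty => simp
  | cons a S ih => simp [ih]

open scoped Classical in
/-- Main theorem, disk case: if `K` is a closed disk of diameter `s` and
`8(s+ε)/ε < k/(n-k)²`, then every rational function `f = p/q` (in lowest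
terms) with at most `n` zeros and poles combined and at least `k` zeros in
`K` has at least `k-1` critical points in the closed `ε`-neighborhood of `K`. -/
theorem stmt_8 (c : ℂ) (s : ℝ) (hs : 0 ≤ s) (K : Set ℂ)
    (hK : K = closedBall c (s / 2)) (n k : ℕ) (hk : 0 < k) (hkn : k < n)
    (ε : ℝ) (hε : 0 < ε)
    (hineq : 8 * (s + ε) / ε < (k : ℝ) / ((n : ℝ) - k) ^ 2)
    (p q : ℂ[X]) (hp : p ≠ 0) (hq : q ≠ 0) (hco : IsCoprime p q)
    (hn : Multiset.card p.roots + Multiset.card q.roots ≤ n)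
    (hkK : k ≤ Multiset.card (p.roots.filter (· ∈ K))) :
    k - 1 ≤ Multiset.card
      (((q * p.derivative - p * q.derivative).roots).filter
        (fun z => infDist z K ≤ ε)) := by
  set P := q * p.derivative - p * q.derivative with hP
  obtain ⟨m, rfl⟩ : ∃ m, n = k + m := ⟨n - k, by omega⟩
  have hm : (1 : ℝ) ≤ m := by exact_mod_cast (by omega : 1 ≤ m)
  set A := p.roots.filter (· ∈ K) with hA
  set B := p.roots.filter (fun z => ¬ z ∈ K) with hB
  have hAB : A + B = p.roots := Multiset.filter_add_not _ _
  have hcard : Multiset.card B + Multiset.card q.roots ≤ m := by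
    rw [← hAB, Multiset.card_add] at hn
    omega
  obtain ⟨r, ⟨hr1, hr2⟩, hrx⟩ := exists_mem_Ioo_forall_le_abs_sub (s / 2) hε
    ((B + q.roots).map fun w => ‖w - c‖) (m := m) (by simpa using hcard)
  set δ : ℝ := ε / (2 * (m + 1)) with hδ
  have hδ0 : 0 < δ := by positivity
  have hr : 0 < r := by linarith
  have hfar : ∀ z ∈ sphere c r, ∀ w ∈ B + q.roots, δ ≤ ‖z - w‖ := by
    intro z hz w hw
    have h1 := hrx _ (Multiset.mem_map_of_mem _ hw)
    have h2 := abs_norm_sub_norm_le (z - c) (w - c)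
    rw [mem_sphere_iff_norm.1 hz, sub_sub_sub_cancel_right] at h2
    exact h1.trans h2
  have hnear : ∀ w ∈ A, ‖w - c‖ ≤ s / 2 := by
    intro w hw
    have := (Multiset.mem_filter.1 hw).2
    rwa [hK, mem_closedBall_iff_norm] at this
  have hre : ∀ z ∈ sphere c r, 0 < (((X - C c) * P).eval z / (p * q).eval z).re := by
    intro z hz
    have hzc : ‖z - c‖ = r := mem_sphere_iff_norm.1 hz
    have hp0 : p.eval z ≠ 0 := by
      intro h0
      have hmem : z ∈ A + B := hAB ▸ (mem_roots hp).2 h0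
      rcases Multiset.mem_add.1 hmem with h | h
      · linarith [hnear z h]
      · have := hfar z hz z (Multiset.mem_add.2 (Or.inl h))
        simp only [sub_self, norm_zero] at this
        linarith
    have hq0 : q.eval z ≠ 0 := by
      intro h0
      have := hfar z hz z (Multiset.mem_add.2 (Or.inr ((mem_roots hq).2 h0)))
      simp only [sub_self, norm_zero] at this
      linarith
    have hquot : ((X - C c) * P).eval z / (p * q).eval z =
        (A.map fun a => (z - c) / (z - a)).sum + (B.map fun a => (z - c) / (z - a)).sum
          - (q.roots.map fun a => (z - c) / (z - a)).sum := by
      have h1 : ((X - C c) * P).eval z / (p * q).eval z =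
          (z - c) * (p.derivative.eval z / p.eval z)
            - (z - c) * (q.derivative.eval z / q.eval z) := by
        simp only [hP, eval_mul, eval_sub, eval_X, eval_C]
        field_simp
      rw [h1, (IsAlgClosed.splits p).eval_derivative_div_eval_of_ne_zero hp0,
        (IsAlgClosed.splits q).eval_derivative_div_eval_of_ne_zero hq0,
        ← Multiset.sum_map_mul_left, ← Multiset.sum_map_mul_left, ← hAB, Multiset.map_add,
        Multiset.sum_add]
      simp only [mul_one_div]
    have habs : ∀ w ∈ B + q.roots, |((z - c) / (z - w)).re| ≤ r / δ := by
      intro w hw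
      refine (Complex.abs_re_le_norm _).trans ?_
      rw [norm_div, hzc]
      have := hfar z hz w hw
      gcongr
    have hAs : (Multiset.card A : ℝ) * (r / (r + s / 2)) ≤
        (A.map fun a => ((z - c) / (z - a)).re).sum := by
      have := Multiset.card_nsmul_le_sum (s := A.map fun a => ((z - c) / (z - a)).re)
        (a := r / (r + s / 2)) (by
          intro x hx
          obtain ⟨w, hw, rfl⟩ := Multiset.mem_map.1 hx
          have := div_add_le_re_div_sub hr hr1 hzc (hnear w hw)
          rwa [sub_sub_sub_cancel_right] at this)
      simpa using this
    have hBs : (Multiset.card B : ℝ) * (-(r / δ)) ≤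
        (B.map fun a => ((z - c) / (z - a)).re).sum := by
      have := Multiset.card_nsmul_le_sum (s := B.map fun a => ((z - c) / (z - a)).re)
        (a := -(r / δ)) (by
          intro x hx
          obtain ⟨w, hw, rfl⟩ := Multiset.mem_map.1 hx
          exact (abs_le.1 (habs w (Multiset.mem_add.2 (Or.inl hw)))).1)
      simpa only [Multiset.card_map, nsmul_eq_mul] using this
    have hQs : (q.roots.map fun a => ((z - c) / (z - a)).re).sum ≤
        (Multiset.card q.roots : ℝ) * (r / δ) := by
      have := Multiset.sum_le_card_nsmul (q.roots.map fun a => ((z - c) / (z - a)).re)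
        (r / δ) (by
          intro x hx
          obtain ⟨w, hw, rfl⟩ := Multiset.mem_map.1 hx
          exact (abs_le.1 (habs w (Multiset.mem_add.2 (Or.inr hw)))).2)
      simpa only [Multiset.card_map, nsmul_eq_mul] using this
    rw [hquot, Complex.sub_re, Complex.add_re, Multiset.re_sum_map, Multiset.re_sum_map,
      Multiset.re_sum_map]
    have hcard' : (Multiset.card B : ℝ) + Multiset.card q.roots ≤ m := by exact_mod_cast hcard
    have hfew : ((Multiset.card B : ℝ) + Multiset.card q.roots) * (r / δ) ≤ m * (r / δ) := by
      gcongr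
    have hmany : (k : ℝ) * (r / (s + ε)) ≤ Multiset.card A * (r / (r + s / 2)) := by
      have : (k : ℝ) ≤ Multiset.card A := by exact_mod_cast hkK
      have hle : r + s / 2 ≤ s + ε := by linarith
      exact mul_le_mul this (div_le_div_of_nonneg_left hr.le (by positivity) hle)
        (by positivity) (by positivity)
    have hmain : (m : ℝ) * (r / δ) < k * (r / (s + ε)) := by
      have hsε : 0 < s + ε := by linarith
      rw [Nat.cast_add, add_sub_cancel_left, div_lt_div_iff₀ hε (by positivity)] at hineq
      have hδε : r / δ = r * (2 * (m + 1)) / ε := by rw [hδ]; field_simp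
      rw [hδε, ← mul_div_assoc, ← mul_div_assoc, div_lt_div_iff₀ hε hsε]
      have h1 : (m : ℝ) * (2 * (m + 1)) * (s + ε) ≤ 8 * (s + ε) * m ^ 2 := by
        nlinarith [mul_nonneg (mul_nonneg hsε.le (by linarith : (0 : ℝ) ≤ m))
          (by linarith : (0 : ℝ) ≤ m - 1), mul_pos hsε (by positivity : (0 : ℝ) < m ^ 2)]
      nlinarith [mul_lt_mul_of_pos_left (h1.trans_lt hineq) hr]
    linarith
  have hP0 : P ≠ 0 := by
    intro h0
    have hz : c + r ∈ sphere c r := by simp [abs_of_pos hr]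
    simpa [h0] using hre _ hz
  have hcount := card_roots_ball_eq_of_re_div_pos hr hre
  rw [roots_mul (mul_ne_zero (X_sub_C_ne_zero c) hP0), roots_mul (mul_ne_zero hp hq),
    roots_X_sub_C, Multiset.filter_add, Multiset.filter_add, Multiset.card_add,
    Multiset.card_add, Multiset.filter_singleton, if_pos (mem_ball_self hr),
    Multiset.card_singleton] at hcount
  have hAle : Multiset.card A ≤ Multiset.card (p.roots.filter (· ∈ ball c r)) := by
    refine Multiset.card_le_card (Multiset.monotone_filter_right _ fun w hw => ?_)
    rw [hK] at hw
    exact closedBall_subset_ball hr1 hw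
  have hPle : Multiset.card (P.roots.filter (· ∈ ball c r)) ≤
      Multiset.card (P.roots.filter fun z => infDist z K ≤ ε) := by
    refine Multiset.card_le_card (Multiset.monotone_filter_right _ fun w hw => ?_)
    have hw' : w ∈ cthickening ε (closedBall c (s / 2)) := by
      rw [cthickening_closedBall hε.le (by positivity)]
      exact ball_subset_closedBall (ball_subset_ball (by linarith) hw)
    rw [hK]
    exact ENNReal.toReal_le_of_le_ofReal hε.le (mem_cthickening_iff.1 hw')
  omega
end

section
/- Let K ⊂ ℂ be bounded convex with diameter s, and let n > k be positive integers with √k > 4(n-k). If ε > 4s(n-k)/(√k - 4(n-k)), then every rational function with at most n zeros and poles combined and at least k zeros in K has at least k-1 critical points in the ε-neighborhood of K. -/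
open Polynomial Metric Bornology

theorem Multiset.exists_map_univ_eq {α : Type*} (m : Multiset α) {N : ℕ} (h : m.card = N) :
    ∃ x : Fin N → α, (Finset.univ : Finset (Fin N)).val.map x = m := by
  obtain ⟨l, rfl⟩ : ∃ l : List α, (l : Multiset α) = m := ⟨m.toList, m.coe_toList⟩
  obtain rfl : l.length = N := h
  exact ⟨l.get, by rw [Fin.univ_val_map, List.ofFn_get]⟩

open scoped Classical in
/-- For a family of polynomials of constant degree whose coefficients depend continuously on a
parameter in a compact space, having at least `j` roots in a closed set is a closed condition. -/
theorem isClosed_setOf_le_card_roots_filter {T : Type*} [TopologicalSpace T] [CompactSpace T]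
    [T2Space T] {P : T → ℂ[X]} {N : ℕ} (hc : ∀ i, Continuous fun t ↦ (P t).coeff i)
    (hN : ∀ t, (P t).natDegree = N) (h0 : ∀ t, P t ≠ 0) {S : Set ℂ} (hS : IsClosed S) (j : ℕ) :
    IsClosed {t | j ≤ ((P t).roots.filter (· ∈ S)).card} := by
  have hlead : ∀ t, (P t).coeff N ≠ 0 := fun t ↦ by
    rw [← hN t]; exact leadingCoeff_ne_zero.2 (h0 t)
  obtain ⟨R, hR⟩ : ∃ R : ℝ, ∀ t, ∀ a ∈ (P t).roots, ‖a‖ ≤ R := by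
    have hcont : Continuous fun t ↦ (∑ i ∈ Finset.range N, ‖(P t).coeff i‖₊) /
        ‖(P t).coeff N‖₊ + 1 := by
      refine (Continuous.div₀ ?_ (hc N).nnnorm fun t ↦ by simpa using hlead t).add continuous_const
      exact continuous_finsetSum _ fun i _ ↦ (hc i).nnnorm
    obtain ⟨R, hR⟩ := (isCompact_range hcont).bddAbove
    refine ⟨R, fun t a ha ↦ ?_⟩
    have h1 := (IsRoot.norm_lt_cauchyBound (h0 t) (isRoot_of_mem_roots ha)).le
    have h2 : cauchyBound (P t) ≤ R := by
      refine le_trans ?_ (hR ⟨t, rfl⟩)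
      rw [cauchyBound, leadingCoeff, hN t]
      beta_reduce
      gcongr
      exact Finset.sup_le fun i hi ↦
        Finset.single_le_sum (f := fun i ↦ ‖(P t).coeff i‖₊) (fun _ _ ↦ zero_le) hi
    exact_mod_cast h1.trans h2
  have heval : ∀ z, Continuous fun t ↦ (P t).eval z := fun z ↦ by
    have : (fun t ↦ (P t).eval z) = fun t ↦ ∑ i ∈ Finset.range (N + 1), (P t).coeff i * z ^ i := by
      ext t; rw [eval_eq_sum_range, hN t]
    rw [this]
    exact continuous_finsetSum _ fun i _ ↦ (hc i).mul continuous_const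
  let Z : Set (T × (Fin N → ℂ)) :=
    (Set.univ ×ˢ Set.univ.pi fun _ ↦ closedBall 0 R) ∩
      ({y | ∀ z, (P y.1).eval z = (P y.1).coeff N * ∏ i, (z - y.2 i)} ∩
        ⋃ I ∈ {I : Finset (Fin N) | j ≤ I.card}, {y | ∀ i ∈ I, y.2 i ∈ S})
  have hZ : IsCompact Z := by
    refine (isCompact_univ.prod (isCompact_univ_pi fun _ ↦ isCompact_closedBall 0 R)).inter_right ?_
    refine IsClosed.inter ?_ ?_
    · simp only [Set.ofPred_forall]
      refine isClosed_iInter fun z ↦ isClosed_eq ((heval z).comp continuous_fst) ?_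
      refine ((hc N).comp continuous_fst).mul (continuous_finsetProd _ fun i _ ↦ ?_)
      fun_prop
    · refine (Set.toFinite _).isClosed_biUnion fun I _ ↦ ?_
      simp only [Set.ofPred_forall]
      exact isClosed_iInter fun i ↦ isClosed_iInter fun _ ↦ hS.preimage (by fun_prop)
  convert! (hZ.image continuous_fst).isClosed
  ext t
  simp only [Set.mem_ofPred_eq, Set.mem_image, Prod.exists, exists_and_right, exists_eq_right]
  constructor
  · intro h
    obtain ⟨x, hx⟩ := Multiset.exists_map_univ_eq (P t).roots
      (((IsAlgClosed.splits (P t)).natDegree_eq_card_roots).symm.trans (hN t))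
    refine ⟨x, ⟨trivial, fun i _ ↦ ?_⟩, fun z ↦ ?_, ?_⟩
    · rw [mem_closedBall_zero_iff]
      exact hR t _ (hx ▸ Multiset.mem_map_of_mem x (Finset.mem_univ i))
    · have := congrArg (eval z) (IsAlgClosed.splits (P t)).eq_prod_roots
      rw [← hx, leadingCoeff, hN t] at this
      rw [this, Multiset.map_map, ← Finset.prod_eq_multiset_prod, eval_mul, eval_C, eval_prod]
      simp
    · rw [← hx, Multiset.filter_map, Multiset.card_map] at h
      exact Set.mem_biUnion (x := Finset.univ.filter fun i ↦ x i ∈ S) h (by simp)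
  · rintro ⟨x, -, hx, hI⟩
    obtain ⟨I, hI, hIS⟩ := Set.mem_iUnion₂.1 hI
    have hroots : (P t).roots = Finset.univ.val.map x := by
      have : P t = C ((P t).coeff N) * ((Finset.univ.val.map x).map fun a ↦ X - C a).prod := by
        refine Polynomial.funext fun z ↦ (hx z).trans ?_
        rw [Multiset.map_map, ← Finset.prod_eq_multiset_prod, eval_mul, eval_C, eval_prod]
        simp
      rw [this, roots_C_mul _ (hlead t), roots_multiset_prod_X_sub_C]
    rw [hroots, Multiset.filter_map, Multiset.card_map]
    refine le_trans hI (Finset.card_le_card (t := Finset.univ.filter fun i ↦ x i ∈ S) fun i hi ↦ ?_)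
    simpa using hIS i hi

open scoped Classical in
/-- If no root of a continuous family of polynomials of constant degree ever crosses a level set of
`φ`, then the number of roots in the sublevel set is constant. -/
theorem card_roots_filter_le_of_forall_eval_ne_zero {T : Type*} [TopologicalSpace T]
    [CompactSpace T] [T2Space T] [PreconnectedSpace T] {P : T → ℂ[X]} {N : ℕ}
    (hc : ∀ i, Continuous fun t ↦ (P t).coeff i) (hN : ∀ t, (P t).natDegree = N)
    (h0 : ∀ t, P t ≠ 0) {φ : ℂ → ℝ} (hφ : Continuous φ) {d : ℝ}
    (hd : ∀ t z, φ z = d → (P t).eval z ≠ 0) (t₀ t₁ : T) :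
    ((P t₀).roots.filter (φ · ≤ d)).card ≤ ((P t₁).roots.filter (φ · ≤ d)).card := by
  set j := ((P t₀).roots.filter (φ · ≤ d)).card with hj
  have hsum : ∀ t, ((P t).roots.filter (φ · ≤ d)).card +
      ((P t).roots.filter (d ≤ φ ·)).card = N := fun t ↦ by
    have h : (P t).roots.filter (d ≤ φ ·) = (P t).roots.filter (¬ φ · ≤ d) :=
      Multiset.filter_congr fun z hz ↦ by
        have := fun h ↦ hd t z h (isRoot_of_mem_roots hz)
        rw [not_le]
        exact ⟨fun h ↦ lt_of_le_of_ne h (Ne.symm this), le_of_lt⟩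
    rw [h, ← Multiset.card_add, Multiset.filter_add_not,
      ← (IsAlgClosed.splits (P t)).natDegree_eq_card_roots, hN t]
  have hclosed := isClosed_setOf_le_card_roots_filter hc hN h0
    (isClosed_le hφ (continuous_const (y := d))) j
  have hclosed' := isClosed_setOf_le_card_roots_filter hc hN h0
    (isClosed_le (continuous_const (y := d)) hφ) (N + 1 - j)
  simp only [Set.mem_ofPred_eq] at hclosed hclosed'
  have hcompl : {t | j ≤ ((P t).roots.filter (φ · ≤ d)).card}ᶜ =
      {t | N + 1 - j ≤ ((P t).roots.filter (d ≤ φ ·)).card} := by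
    ext t
    have := hsum t
    have := hsum t₀
    simp only [Set.mem_compl_iff, Set.mem_ofPred_eq]
    omega
  have huniv := IsClopen.eq_univ
    ⟨hclosed, isClosed_compl_iff.1 (hcompl ▸ hclosed')⟩
    ⟨t₀, le_refl j⟩
  exact Set.eq_univ_iff_forall.1 huniv t₁

theorem Polynomial.coeff_X_mul_derivative {R : Type*} [CommSemiring R] (p : R[X]) (i : ℕ) :
    (X * derivative p).coeff i = i * p.coeff i := by
  cases i with
  | zero => simp
  | succ i => rw [coeff_X_mul, coeff_derivative]; push_cast; ring

theorem Polynomial.natDegree_X_mul_derivative_le {R : Type*} [CommSemiring R] (p : R[X]) :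
    (X * derivative p).natDegree ≤ p.natDegree :=
  natDegree_le_iff_coeff_eq_zero.2 fun i hi ↦ by
    rw [coeff_X_mul_derivative, coeff_eq_zero_of_natDegree_lt hi, mul_zero]

/-- The numerator of `u' / u + t * (v' / v - q' / q)`. -/
noncomputable def logDerivNumerator (u v q : ℂ[X]) (t : ℂ) : ℂ[X] :=
  q * v * derivative u + C t * (u * (q * derivative v - v * derivative q))

theorem logDerivNumerator_natDegree {u v q : ℂ[X]} (hu : u ≠ 0) (hv : v ≠ 0) (hq : q ≠ 0)
    (hdeg : q.natDegree < u.natDegree) {t : ℝ} (ht : t ∈ Set.Icc (0 : ℝ) 1) :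
    logDerivNumerator u v q t ≠ 0 ∧
      (logDerivNumerator u v q t).natDegree = u.natDegree + v.natDegree + q.natDegree - 1 := by
  set F := logDerivNumerator u v q t with hF
  have hXF : X * F = q * v * (X * derivative u) +
      C (t : ℂ) * (u * (q * (X * derivative v) - v * (X * derivative q))) := by
    rw [hF, logDerivNumerator]; ring
  have hu' := natDegree_X_mul_derivative_le u
  have hv' := natDegree_X_mul_derivative_le v
  have hq' := natDegree_X_mul_derivative_le q
  have hqv : (q * (X * derivative v)).natDegree ≤ q.natDegree + v.natDegree :=
    natDegree_mul_le_of_le le_rfl hv'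
  have hvq : (v * (X * derivative q)).natDegree ≤ q.natDegree + v.natDegree :=
    (natDegree_mul_le_of_le le_rfl hq').trans_eq (add_comm _ _)
  have hdiff := natDegree_sub_le_of_le hqv hvq
  rw [max_self] at hdiff
  have hle : (X * F).natDegree ≤ u.natDegree + (q.natDegree + v.natDegree) := by
    rw [hXF]
    refine natDegree_add_le_of_degree_le ?_ ?_
    · exact (natDegree_mul_le_of_le natDegree_mul_le hu').trans_eq (add_comm _ _)
    · exact (natDegree_C_mul_le _ _).trans (natDegree_mul_le_of_le le_rfl hdiff)
  have hcoeff : (X * F).coeff (u.natDegree + (q.natDegree + v.natDegree)) =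
      u.leadingCoeff * v.leadingCoeff * q.leadingCoeff *
        ((u.natDegree + t * (v.natDegree - q.natDegree) : ℝ) : ℂ) := by
    rw [hXF, coeff_add, coeff_C_mul, coeff_mul_add_eq_of_natDegree_le le_rfl hdiff, coeff_sub,
      coeff_mul_add_eq_of_natDegree_le le_rfl hv', mul_comm (q * v),
      coeff_mul_add_eq_of_natDegree_le hu' natDegree_mul_le, coeff_mul_add_eq_of_natDegree_le le_rfl le_rfl,
      add_comm q.natDegree, coeff_mul_add_eq_of_natDegree_le le_rfl hq']
    simp only [coeff_X_mul_derivative, leadingCoeff]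
    push_cast
    ring
  have hpos : 0 < (u.natDegree + t * (v.natDegree - q.natDegree) : ℝ) := by
    have h1 : (q.natDegree : ℝ) < u.natDegree := by exact_mod_cast hdeg
    have h2 : 0 ≤ t * (v.natDegree : ℝ) := mul_nonneg ht.1 (Nat.cast_nonneg _)
    have h3 : t * (q.natDegree : ℝ) ≤ q.natDegree :=
      mul_le_of_le_one_left (Nat.cast_nonneg _) ht.2
    linarith
  have hne : (X * F).coeff (u.natDegree + (q.natDegree + v.natDegree)) ≠ 0 := by
    rw [hcoeff]
    refine mul_ne_zero (mul_ne_zero (mul_ne_zero ?_ ?_) ?_) (by exact_mod_cast hpos.ne') <;>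
      simpa
  have hF0 : F ≠ 0 := fun h ↦ hne (by rw [h]; simp)
  refine ⟨hF0, ?_⟩
  have := natDegree_eq_of_le_of_coeff_ne_zero hle hne
  rw [natDegree_X_mul hF0] at this
  omega

theorem eval_logDerivNumerator_ne_zero {u v q : ℂ[X]} {z : ℂ} (hu : u.eval z ≠ 0)
    (hv : v.eval z ≠ 0) (hq : q.eval z ≠ 0)
    (h : ‖(v.roots.map fun w ↦ 1 / (z - w)).sum - (q.roots.map fun w ↦ 1 / (z - w)).sum‖ <
      ‖(u.roots.map fun w ↦ 1 / (z - w)).sum‖) {t : ℝ} (ht : t ∈ Set.Icc (0 : ℝ) 1) :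
    (logDerivNumerator u v q t).eval z ≠ 0 := by
  rw [← (IsAlgClosed.splits u).eval_derivative_div_eval_of_ne_zero hu,
    ← (IsAlgClosed.splits v).eval_derivative_div_eval_of_ne_zero hv,
    ← (IsAlgClosed.splits q).eval_derivative_div_eval_of_ne_zero hq] at h
  have hfac : (logDerivNumerator u v q t).eval z = u.eval z * v.eval z * q.eval z *
      ((derivative u).eval z / u.eval z + t * ((derivative v).eval z / v.eval z -
        (derivative q).eval z / q.eval z)) := by
    simp only [logDerivNumerator, eval_add, eval_mul, eval_sub, eval_C]
    field_simp
  rw [hfac]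
  refine mul_ne_zero (mul_ne_zero (mul_ne_zero hu hv) hq) fun h0 ↦ h.not_ge ?_
  rw [eq_neg_of_add_eq_zero_left h0, norm_neg, norm_mul, Complex.norm_real,
    Real.norm_of_nonneg ht.1]
  exact mul_le_of_le_one_left (norm_nonneg _) ht.2

/-- A lower bound for the logarithmic derivative of a polynomial with all its roots in a convex
set `K`, at a point outside `closure K`. -/
theorem card_mul_le_norm_sum_one_div_sub {K : Set ℂ} (hconv : Convex ℝ K) (hne : K.Nonempty)
    (hbd : IsBounded K) {z : ℂ} (hz : 0 < infDist z K) {m : Multiset ℂ} (hm : ∀ w ∈ m, w ∈ K) :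
    m.card * (infDist z K / (infDist z K + diam K) ^ 2) ≤
      ‖(m.map fun w ↦ 1 / (z - w)).sum‖ := by
  obtain ⟨y, hy, hzy⟩ := isClosed_closure.exists_infDist_eq_dist hne.closure z
  rw [infDist_closure] at hzy
  set d := infDist z K with hd
  have hnorm : ‖z - y‖ = d := by rw [hzy, dist_eq_norm]
  have hinner : ∀ w ∈ closure K, inner ℝ (z - y) (w - y) ≤ 0 := by
    refine (norm_eq_iInf_iff_real_inner_le_zero hconv.closure hy).1 ?_
    rw [hnorm, hd, ← infDist_closure, infDist_eq_iInf]
    simp only [dist_eq_norm]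
  have hre : ∀ w ∈ K, d ^ 2 / (d + diam K) ^ 2 ≤ ((z - y) * (1 / (z - w))).re := by
    intro w hw
    have hdw : d ≤ ‖z - w‖ := by rw [← dist_eq_norm]; exact infDist_le_dist_of_mem hw
    have hle : ‖z - w‖ ≤ d + diam K := by
      have h1 := dist_le_diam_of_mem hbd.closure hy (subset_closure hw)
      rw [diam_closure] at h1
      have h2 := dist_triangle z y w
      rw [← hzy] at h2
      rw [← dist_eq_norm]
      linarith
    have hin : d ^ 2 ≤ inner ℝ (z - y) (z - w) := by
      have h1 := hinner w (subset_closure hw)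
      have h2 : z - w = (z - y) - (w - y) := by ring
      rw [h2, inner_sub_right, real_inner_self_eq_norm_sq, hnorm]
      linarith
    have hform : ((z - y) * (1 / (z - w))).re = inner ℝ (z - y) (z - w) / ‖z - w‖ ^ 2 := by
      rw [Complex.inner, ← Complex.normSq_eq_norm_sq, mul_one_div, Complex.div_re]
      simp only [Complex.mul_re, Complex.conj_re, Complex.conj_im]
      ring
    rw [hform]
    have := hz.trans_le hdw
    exact div_le_div₀ ((sq_nonneg d).trans hin) hin (by positivity) (by gcongr)
  have hsum : m.card * (d ^ 2 / (d + diam K) ^ 2) ≤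
      ((z - y) * (m.map fun w ↦ 1 / (z - w)).sum).re := by
    induction m using Multiset.induction with
    | empty => simp
    | cons a m ih =>
      have h1 := ih fun w hw ↦ hm w (Multiset.mem_cons_of_mem hw)
      have h2 := hre a (hm a (Multiset.mem_cons_self a m))
      rw [Multiset.map_cons, Multiset.sum_cons, mul_add, Complex.add_re, Multiset.card_cons]
      push_cast
      linarith
  refine le_of_mul_le_mul_left ?_ hz
  calc d * (m.card * (d / (d + diam K) ^ 2)) = m.card * (d ^ 2 / (d + diam K) ^ 2) := by ring
    _ ≤ _ := hsum.trans (Complex.re_le_norm _)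
    _ = _ := by rw [norm_mul, hnorm]

theorem norm_sum_one_div_sub_le {z : ℂ} {δ : ℝ} (hδ : 0 < δ) {m : Multiset ℂ}
    (hm : ∀ w ∈ m, δ ≤ ‖z - w‖) : ‖(m.map fun w ↦ 1 / (z - w)).sum‖ ≤ m.card / δ := by
  induction m using Multiset.induction with
  | empty => simp
  | cons a m ih =>
    have h1 := ih fun w hw ↦ hm w (Multiset.mem_cons_of_mem hw)
    have h2 : ‖1 / (z - a)‖ ≤ 1 / δ := by
      rw [norm_div, norm_one]
      exact one_div_le_one_div_of_le hδ (hm a (Multiset.mem_cons_self a m))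
    rw [Multiset.map_cons, Multiset.sum_cons, Multiset.card_cons]
    refine (norm_add_le _ _).trans ((add_le_add h2 h1).trans_eq ?_)
    push_cast
    ring

theorem exists_forall_le_abs_sub_s9 (W : Finset ℝ) (a : ℝ) {δ : ℝ} (hδ : 0 < δ) :
    ∃ i ≤ W.card, ∀ r ∈ W, δ ≤ |a + 2 * δ * (i : ℕ) - r| := by
  by_contra! h
  choose! f hfW hf using h
  obtain ⟨i, hi, j, hj, hij, hfij⟩ := Finset.exists_ne_map_eq_of_card_lt_of_maps_to
    (s := Finset.range (W.card + 1)) (t := W) (f := f) (by simp)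
    (fun i hi ↦ hfW i (Finset.mem_range_succ_iff.1 hi))
  have h1 := abs_lt.1 (hf i (Finset.mem_range_succ_iff.1 hi))
  have h2 := abs_lt.1 (hf j (Finset.mem_range_succ_iff.1 hj))
  rw [hfij] at h1
  have h3 : ((i : ℝ) - j) < 1 := by
    by_contra! h
    nlinarith
  have h4 : ((j : ℝ) - i) < 1 := by
    by_contra! h
    nlinarith
  apply hij
  have h5 : i < j + 1 := by exact_mod_cast (by linarith : (i : ℝ) < j + 1)
  have h6 : j < i + 1 := by exact_mod_cast (by linarith : (j : ℝ) < i + 1)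
  omega

/-- The Gauss–Lucas theorem, counting roots with multiplicity. -/
theorem mem_of_mem_roots_derivative {K : Set ℂ} (hconv : Convex ℝ K) {u : ℂ[X]}
    (hu : ∀ w ∈ u.roots, w ∈ K) {z : ℂ} (hz : z ∈ (derivative u).roots) : z ∈ K := by
  have hu0 : derivative u ≠ 0 := fun h ↦ by simp [h] at hz
  have hdeg : 0 < u.degree := by
    rw [← natDegree_pos_iff_degree_pos]
    exact Nat.pos_of_ne_zero fun h ↦ hu0 (derivative_of_natDegree_zero h)
  refine convexHull_min ?_ hconv (rootSet_derivative_subset_convexHull_rootSet hdeg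
    ((mem_rootSet_of_ne hu0).2 ?_))
  · intro w hw
    refine hu w ((mem_roots ?_).2 ?_)
    · exact ne_zero_of_degree_gt hdeg
    · simpa using aeval_eq_zero_of_mem_rootSet hw
  · simpa using isRoot_of_mem_roots hz

open scoped Classical in
/-- If the roots of `u` dominate those of `v` and `q` in the logarithmic derivative along the level
set `infDist · K = d`, then `u * v / q` has at least `u.natDegree - 1` critical points in the
closed `d`-neighborhood of `K`. -/
theorem natDegree_sub_one_le_card_critical {K : Set ℂ} (hconv : Convex ℝ K) {u v q : ℂ[X]}
    (hu : u ≠ 0) (hv : v ≠ 0) (hq : q ≠ 0) (hdeg : q.natDegree < u.natDegree)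
    (huK : ∀ w ∈ u.roots, w ∈ K) {d : ℝ} (hd : 0 ≤ d)
    (h : ∀ z, infDist z K = d → u.eval z ≠ 0 ∧ v.eval z ≠ 0 ∧ q.eval z ≠ 0 ∧
      ‖(v.roots.map fun w ↦ 1 / (z - w)).sum - (q.roots.map fun w ↦ 1 / (z - w)).sum‖ <
        ‖(u.roots.map fun w ↦ 1 / (z - w)).sum‖) :
    u.natDegree - 1 ≤ ((q * derivative (u * v) - u * v * derivative q).roots.filter
      (infDist · K ≤ d)).card := by
  have hcont : ∀ i, Continuous fun t : unitInterval ↦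
      (logDerivNumerator u v q ((t : ℝ) : ℂ)).coeff i := fun i ↦ by
    simp only [logDerivNumerator, coeff_add, coeff_C_mul]
    fun_prop
  have key := card_roots_filter_le_of_forall_eval_ne_zero hcont
    (fun t ↦ (logDerivNumerator_natDegree hu hv hq hdeg t.2).2)
    (fun t ↦ (logDerivNumerator_natDegree hu hv hq hdeg t.2).1) (continuous_infDist_pt K)
    (fun t z hz ↦ eval_logDerivNumerator_ne_zero (h z hz).1 (h z hz).2.1 (h z hz).2.2.1
      (h z hz).2.2.2 t.2) 0 1
  have h0 : logDerivNumerator u v q ((0 : unitInterval) : ℝ) = q * v * derivative u := by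
    simp [logDerivNumerator]
  have h1 : logDerivNumerator u v q ((1 : unitInterval) : ℝ) =
      q * derivative (u * v) - u * v * derivative q := by
    simp only [logDerivNumerator, Set.Icc.coe_one, Complex.ofReal_one, C_1, derivative_mul]
    ring
  rw [h0, h1] at key
  refine le_trans ?_ key
  have hu' : derivative u ≠ 0 := fun h ↦ by
    have := derivative_eq_zero.1 h
    omega
  rw [← natDegree_derivative, (IsAlgClosed.splits _).natDegree_eq_card_roots]
  refine Multiset.card_le_card (Multiset.le_filter.2 ⟨?_, fun z hz ↦ ?_⟩)
  · exact roots.le_of_dvd (mul_ne_zero (mul_ne_zero hq hv) hu') (dvd_mul_left _ _)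
  · rw [infDist_zero_of_mem (mem_of_mem_roots_derivative hconv huK hz)]
    exact hd

open scoped Classical in
/-- Corollary: if `√k > 4(n-k)` and `ε > 4s(n-k)/(√k - 4(n-k))`, then every
rational function `f = p/q` (in lowest terms) with at most `n` zeros and
poles combined and at least `k` zeros in `K` has at least `k-1` critical
points in the closed `ε`-neighborhood of `K`. -/
theorem stmt_9 (K : Set ℂ) (hconv : Convex ℝ K) (hbd : IsBounded K)
    (s : ℝ) (hs : s = diam K) (n k : ℕ) (hk : 0 < k) (hkn : k < n)
    (hsqrt : 4 * ((n : ℝ) - k) < Real.sqrt k)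
    (ε : ℝ) (hε : 4 * s * ((n : ℝ) - k) / (Real.sqrt k - 4 * ((n : ℝ) - k)) < ε)
    (p q : ℂ[X]) (hp : p ≠ 0) (hq : q ≠ 0) (hco : IsCoprime p q)
    (hn : Multiset.card p.roots + Multiset.card q.roots ≤ n)
    (hkK : k ≤ Multiset.card (p.roots.filter (· ∈ K))) :
    k - 1 ≤ Multiset.card
      (((q * p.derivative - p * q.derivative).roots).filter
        (fun z => infDist z K ≤ ε)) := by
  have hcast : (((n - k : ℕ) : ℝ)) = n - k := Nat.cast_sub hkn.le
  rw [← hcast] at hsqrt hε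
  obtain ⟨m, hm⟩ : ∃ m, m = n - k := ⟨_, rfl⟩
  rw [← hm] at hsqrt hε
  have hm0 : (0 : ℝ) < m := by exact_mod_cast (by omega : 0 < m)
  have hs0 : 0 ≤ s := hs ▸ diam_nonneg
  have hε0 : 0 < ε := lt_of_le_of_lt (div_nonneg (by positivity) (by linarith)) hε
  have hkε : 16 * (m : ℝ) ^ 2 * (ε + s) ^ 2 < k * ε ^ 2 := by
    rw [div_lt_iff₀ (by linarith)] at hε
    have h1 : 4 * m * (ε + s) < Real.sqrt k * ε := by linarith
    have h2 := pow_lt_pow_left₀ h1 (by positivity) two_ne_zero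
    rw [mul_pow (Real.sqrt k), Real.sq_sqrt (Nat.cast_nonneg _)] at h2
    linarith
  set mu := p.roots.filter (· ∈ K) with hmu
  set mv := p.roots.filter (· ∉ K) with hmv
  have hcard : mu.card + mv.card = p.roots.card := by
    rw [← Multiset.card_add, Multiset.filter_add_not]
  set u : ℂ[X] := (mu.map fun a ↦ X - C a).prod with hu_def
  set v : ℂ[X] := C p.leadingCoeff * (mv.map fun a ↦ X - C a).prod with hv_def
  have hpuv : p = u * v := by
    rw [hu_def, hv_def, mul_left_comm, ← Multiset.prod_add, ← Multiset.map_add,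
      Multiset.filter_add_not]
    exact (IsAlgClosed.splits p).eq_prod_roots
  have hur : u.roots = mu := roots_multiset_prod_X_sub_C mu
  have hvr : v.roots = mv := by
    rw [hv_def, roots_C_mul _ (leadingCoeff_ne_zero.2 hp), roots_multiset_prod_X_sub_C]
  have hu : u ≠ 0 := fun h ↦ hp (by rw [hpuv, h, zero_mul])
  have hv : v ≠ 0 := fun h ↦ hp (by rw [hpuv, h, mul_zero])
  have hudeg : u.natDegree = mu.card := by
    rw [(IsAlgClosed.splits u).natDegree_eq_card_roots, hur]
  have hqdeg : q.natDegree = q.roots.card := (IsAlgClosed.splits q).natDegree_eq_card_roots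
  have hmk : m < k := by
    have h1 : (1 : ℝ) ≤ m := by exact_mod_cast (by omega : 1 ≤ m)
    have h2 := (Real.lt_sqrt (by positivity)).1 hsqrt
    exact_mod_cast (by nlinarith : (m : ℝ) < k)
  have huK : ∀ w ∈ u.roots, w ∈ K := fun w hw ↦ (Multiset.mem_filter.1 (hur ▸ hw)).2
  have hne : K.Nonempty := by
    obtain ⟨w, hw⟩ := Multiset.card_pos_iff_exists_mem.1 (hk.trans_le hkK)
    exact ⟨w, (Multiset.mem_filter.1 hw).2⟩
  obtain ⟨δ, hδ⟩ : ∃ δ, δ = ε / (4 * m) := ⟨_, rfl⟩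
  have hδ0 : 0 < δ := by rw [hδ]; positivity
  obtain ⟨i, hi, hgap⟩ := exists_forall_le_abs_sub_s9
    ((mv + q.roots).map (infDist · K)).toFinset (ε / 2) hδ0
  have him : (i : ℝ) ≤ m := by
    have := hi.trans (Multiset.toFinset_card_le _)
    rw [Multiset.card_map, Multiset.card_add] at this
    exact_mod_cast (by omega : i ≤ m)
  set d := ε / 2 + 2 * δ * i with hd
  have hdlow : ε / 2 ≤ d := le_add_of_nonneg_right (by positivity)
  have hdhigh : d ≤ ε := by
    have h1 : 2 * δ * i ≤ 2 * δ * m := by gcongr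
    have h2 : 2 * δ * m = ε / 2 := by rw [hδ]; field_simp; norm_num
    linarith
  have hd0 : 0 < d := by linarith
  have hdist : ∀ z, infDist z K = d → ∀ w ∈ mv + q.roots, δ ≤ ‖z - w‖ := by
    intro z hz w hw
    refine (hgap (infDist w K) (by
      rw [Multiset.mem_toFinset]; exact Multiset.mem_map_of_mem _ hw)).trans ?_
    rw [← hz, ← Real.dist_eq, ← dist_eq_norm]
    simpa using (lipschitz_infDist_pt K).dist_le_mul z w
  have heval : ∀ z, infDist z K = d → ∀ f : ℂ[X], f ≠ 0 → f.roots ≤ mv + q.roots →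
      f.eval z ≠ 0 := by
    intro z hz f hf hle h0
    have := hdist z hz z (Multiset.mem_of_le hle ((mem_roots hf).2 h0))
    rw [sub_self, norm_zero] at this
    linarith
  have hcrit := natDegree_sub_one_le_card_critical hconv hu hv hq (by omega) huK hd0.le
    (fun z hz ↦ by
      refine ⟨fun h0 ↦ ?_, heval z hz v hv (by simp [hvr]), heval z hz q hq (by simp), ?_⟩
      · rw [infDist_zero_of_mem (huK z ((mem_roots hu).2 h0))] at hz
        linarith
      have hz0 : 0 < infDist z K := hz ▸ hd0
      have hlow := card_mul_le_norm_sum_one_div_sub hconv hne hbd hz0 huK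
      refine lt_of_lt_of_le ?_ hlow
      have h1 := norm_sum_one_div_sub_le hδ0 (m := v.roots) fun w hw ↦
        hdist z hz w (Multiset.mem_add.2 (Or.inl (hvr ▸ hw)))
      have h2 := norm_sum_one_div_sub_le hδ0 (m := q.roots) fun w hw ↦
        hdist z hz w (Multiset.mem_add.2 (Or.inr hw))
      have h3 : (v.roots.card : ℝ) + q.roots.card ≤ m := by
        rw [hvr]; exact_mod_cast (by omega : mv.card + q.roots.card ≤ m)
      rw [hz, hur, ← hs]
      calc _ ≤ _ := (norm_sub_le _ _).trans (add_le_add h1 h2)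
        _ = (v.roots.card + q.roots.card : ℝ) / δ := by ring
        _ ≤ m / δ := by gcongr
        _ = 4 * m ^ 2 / ε := by rw [hδ]; field_simp
        _ < k * ((ε / 2) / (ε + s) ^ 2) := by
          rw [← mul_div_assoc, div_lt_div_iff₀ hε0 (by positivity)]
          nlinarith [show 0 < (m : ℝ) ^ 2 * (ε + s) ^ 2 by positivity]
        _ ≤ mu.card * (d / (d + s) ^ 2) := by
          have : (k : ℝ) ≤ mu.card := by exact_mod_cast hkK
          gcongr)
  rw [← hpuv] at hcrit
  calc k - 1 ≤ u.natDegree - 1 := by omega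
    _ ≤ _ := hcrit
    _ ≤ _ := Multiset.card_le_card
      (Multiset.monotone_filter_right _ fun z hz ↦ hz.trans hdhigh)
end
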